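/- Let H be a finite-dimensional vector space over 𝔽₂ with an alternating bilinear form B, let q and q′ be quadratic forms on (H,B), and let Δ ∈ H satisfy q′(x) = q(x) + B(Δ,x) for all x ∈ H. Then q(Δ) = q′(Δ), and the Gauss sums satisfy S(q) = (−1)^{q(Δ)}·S(q′). -/

import Mathlib

theorem ZMod.neg_one_pow_val_add (a b : ZMod 2) :
    (-1 : ℤ) ^ (a + b).val = (-1) ^ a.val * (-1) ^ b.val := by
  revert a b
  decide

/-- Let `H` be a finite-dimensional vector space over `𝔽₂` with an alternating bilinear
form `B`, let `q` and `q′` be quadratic forms on `(H,B)`, and let `Δ ∈ H` satisfy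
`q′(x) = q(x) + B(Δ,x)` for all `x`.  Then `q(Δ) = q′(Δ)` and the Gauss sums satisfy
`S(q) = (−1)^{q(Δ)}·S(q′)`. -/
theorem gauss_sum_eq_neg_one_pow_mul
    (H : Type) [AddCommGroup H] [Module (ZMod 2) H] [Fintype H]
    (B : H →ₗ[ZMod 2] H →ₗ[ZMod 2] ZMod 2)
    (halt : ∀ x, B x x = 0)
    (q q' : H → ZMod 2)
    (hq : ∀ a b, q (a + b) = q a + q b + B a b)
    (hq' : ∀ a b, q' (a + b) = q' a + q' b + B a b)
    (Δ : H)
    (hΔ : ∀ x, q' x = q x + B Δ x) :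
    q Δ = q' Δ ∧
      (∑ y, (-1 : ℤ) ^ (q y).val)
        = (-1 : ℤ) ^ (q Δ).val * ∑ y, (-1 : ℤ) ^ (q' y).val := by
  refine ⟨by rw [hΔ, halt, add_zero], ?_⟩
  rw [Finset.mul_sum, ← Equiv.sum_comp (Equiv.addLeft Δ)]
  refine Finset.sum_congr rfl fun y _ => ?_
  rw [Equiv.coe_addLeft, hq, add_assoc, ← hΔ, ZMod.neg_one_pow_val_add]
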